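/- arXiv:2502.03113 — 3 statements merged into one kernel-verified Lean document; each statement's English description precedes it below -/
import Mathlib

section
/- Let T ⊆ X × Y × Z be a 3DM-3 instance (|X|=|Y|=|Z|=n, |T| ≥ n, every element of X ∪ Y ∪ Z occurs in exactly 2 or 3 triples of T) and let G_T be the associated scheduling game with rank-based utilities. If T contains a perfect 3-dimensional matching (a subset T' ⊆ T with |T'| = n in which every element of X ∪ Y ∪ Z appears exactly once), then G_T admits a pure Nash equilibrium. -/
open Finset
open scoped Classical

noncomputable section

variable {J M : Type*} [Fintype J]

/-- Completion time of job `j` in profile `s`: the total processing time of the jobs on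
`j`'s machine that do not come after `j` in that machine's priority list, divided by the speed. -/
def Ctime (p : J → ℝ) (r : M → ℝ) (π : M → J → ℕ) (s : J → M) (j : J) : ℝ :=
  (∑ j' ∈ univ.filter (fun j' => s j' = s j ∧ π (s j) j' ≤ π (s j) j), p j') / r (s j)

/-- Rank of job `j` in profile `s`. -/
def rankOf (p : J → ℝ) (r : M → ℝ) (π : M → J → ℕ) (s : J → M) (j : J) : ℝ :=
  ((univ.filter (fun j' => Ctime p r π s j' < Ctime p r π s j)).card : ℝ) +
    (((univ.filter (fun j' => Ctime p r π s j' = Ctime p r π s j)).card : ℝ) + 1) / 2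

/-- The unilateral deviation of job `j` to machine `i` is beneficial. -/
def Beneficial (p : J → ℝ) (r : M → ℝ) (π : M → J → ℕ) (s : J → M) (j : J) (i : M) : Prop :=
  rankOf p r π (Function.update s j i) j < rankOf p r π s j ∨
    (rankOf p r π (Function.update s j i) j = rankOf p r π s j ∧
      Ctime p r π (Function.update s j i) j < Ctime p r π s j)

/-- Pure Nash equilibrium: no job has a beneficial deviation. -/
def IsNE (p : J → ℝ) (r : M → ℝ) (π : M → J → ℕ) (s : J → M) : Prop :=
  ∀ j i, ¬ Beneficial p r π s j i

variable {X Y Z : Type*} [Fintype X] [Fintype Y] [Fintype Z]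
  [DecidableEq X] [DecidableEq Y] [DecidableEq Z]

/-- The dummy jobs of type `i`: for each `x : X`, `τ_x - 1` jobs of length `2`,
where `τ_x` is the number of triples of `T` containing `x`. -/
abbrev DJob (T : Finset (X × Y × Z)) : Type _ :=
  Σ x : X, Fin ((T.filter (fun t => t.1 = x)).card - 1)

/-- The jobs of the game `G_T`: one job per element of `Y`, one per element of `Z`,
the dummy jobs `D`, and the two sets `U` and `V` of dummy unit jobs (one per triple). -/
abbrev Job3DM (T : Finset (X × Y × Z)) : Type _ :=
  Y ⊕ Z ⊕ DJob T ⊕ {t // t ∈ T} ⊕ {t // t ∈ T}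

/-- Processing times in `G_T`: dummy jobs in `D` have length `2`, all other jobs are unit. -/
def pJob (T : Finset (X × Y × Z)) : Job3DM T → ℝ :=
  Sum.elim (fun _ => 1) (Sum.elim (fun _ => 1) (Sum.elim (fun _ => 2)
    (Sum.elim (fun _ => 1) (fun _ => 1))))

/-- The block index of a job in the priority list of machine `ℓ` corresponding to a
triple `t_ℓ = (x_i, y_j, z_k)`; the blocks are, in order:
`D_i, y_j, z_k, U, v_ℓ, V \ {v_ℓ}, D \ D_i, Y \ {y_j}, Z \ {z_k}`. -/
def blk (T : Finset (X × Y × Z)) (ℓ : {t // t ∈ T}) : Job3DM T → ℕ := fun job =>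
  match job with
  | Sum.inl y => if y = ℓ.1.2.1 then 1 else 7
  | Sum.inr (Sum.inl z) => if z = ℓ.1.2.2 then 2 else 8
  | Sum.inr (Sum.inr (Sum.inl d)) => if d.1 = ℓ.1.1 then 0 else 6
  | Sum.inr (Sum.inr (Sum.inr (Sum.inl _))) => 3
  | Sum.inr (Sum.inr (Sum.inr (Sum.inr v))) => if v = ℓ then 4 else 5

/-- The fixed internal order between two jobs of the same kind. -/
def withinOrd (T : Finset (X × Y × Z)) (ordY : Y → ℕ) (ordZ : Z → ℕ)
    (ordD : DJob T → ℕ) (ordU ordV : {t // t ∈ T} → ℕ) :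
    Job3DM T → Job3DM T → Prop := fun a b =>
  match a, b with
  | Sum.inl a, Sum.inl b => ordY a < ordY b
  | Sum.inr (Sum.inl a), Sum.inr (Sum.inl b) => ordZ a < ordZ b
  | Sum.inr (Sum.inr (Sum.inl a)), Sum.inr (Sum.inr (Sum.inl b)) => ordD a < ordD b
  | Sum.inr (Sum.inr (Sum.inr (Sum.inl a))), Sum.inr (Sum.inr (Sum.inr (Sum.inl b))) =>
      ordU a < ordU b
  | Sum.inr (Sum.inr (Sum.inr (Sum.inr a))), Sum.inr (Sum.inr (Sum.inr (Sum.inr b))) =>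
      ordV a < ordV b
  | _, _ => False

section Generic

variable {J M : Type*} [Fintype J]

/-- The profile after the deviation of `j` to `i`. -/
abbrev devJ (s : J → M) (j : J) (i : M) : J → M := Function.update s j i

theorem rank_mono_aux (p : J → ℝ) (r : M → ℝ) (π : M → J → ℕ) (s s' : J → M) (j : J)
    (σ : J → J) (hσ : Function.Injective σ) (hσj : σ j = j)
    (hc : Ctime p r π s j ≤ Ctime p r π s' j)
    (h : ∀ k, k ≠ j → Ctime p r π s k ≤ Ctime p r π s j →
      Ctime p r π s' (σ k) ≤ Ctime p r π s k) :
    rankOf p r π s j ≤ rankOf p r π s' j := by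
  unfold rankOf
  generalize Ctime p r π s = C at *
  generalize Ctime p r π s' = C' at *
  have key : ∀ D : J → ℝ, ((univ.filter (fun k => D k ≤ D j)).card : ℝ) =
      ((univ.filter (fun k => D k < D j)).card : ℝ) +
      ((univ.filter (fun k => D k = D j)).card : ℝ) := by
    intro D
    rw [← Nat.cast_add, ← Finset.card_union_of_disjoint]
    · congr 2
      ext k
      simp [le_iff_lt_or_eq]
    · rw [Finset.disjoint_left]
      intro k hk hk'
      simp only [mem_filter, mem_univ, true_and] at hk hk'
      linarith
  have h1 : (univ.filter (fun k => C k < C j)).card ≤ (univ.filter (fun k => C' k < C' j)).card := by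
    apply Finset.card_le_card_of_injOn σ _ (hσ.injOn)
    intro k hk
    simp only [coe_filter, mem_univ, true_and, Set.mem_ofPred_eq] at hk ⊢
    have hkj : k ≠ j := by rintro rfl; exact lt_irrefl _ hk
    have := h k hkj hk.le
    linarith
  have h2 : (univ.filter (fun k => C k ≤ C j)).card ≤ (univ.filter (fun k => C' k ≤ C' j)).card := by
    apply Finset.card_le_card_of_injOn σ _ (hσ.injOn)
    intro k hk
    simp only [coe_filter, mem_univ, true_and, Set.mem_ofPred_eq] at hk ⊢
    by_cases hkj : k = j
    · subst hkj; rw [hσj]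
    · have := h k hkj hk
      linarith
  have h1' : ((univ.filter (fun k => C k < C j)).card : ℝ) ≤
    ((univ.filter (fun k => C' k < C' j)).card : ℝ) := by exact_mod_cast h1
  have h2' : ((univ.filter (fun k => C k ≤ C j)).card : ℝ) ≤
    ((univ.filter (fun k => C' k ≤ C' j)).card : ℝ) := by exact_mod_cast h2
  rw [key C, key C'] at h2'
  linarith

theorem not_beneficial_aux (p : J → ℝ) (r : M → ℝ) (π : M → J → ℕ) (s : J → M) (j : J) (i : M)
    (σ : J → J) (hσ : Function.Injective σ) (hσj : σ j = j)
    (hc : Ctime p r π s j ≤ Ctime p r π (Function.update s j i) j)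
    (h : ∀ k, k ≠ j → Ctime p r π s k ≤ Ctime p r π s j →
      Ctime p r π (Function.update s j i) (σ k) ≤ Ctime p r π s k) :
    ¬ Beneficial p r π s j i := by
  have := rank_mono_aux p r π s _ j σ hσ hσj hc h
  rintro (h1 | ⟨_, h1⟩) <;> linarith

theorem Ctime_one (p : J → ℝ) (π : M → J → ℕ) (s : J → M) (j : J) :
    Ctime p (fun _ => (1:ℝ)) π s j =
      ∑ j' ∈ univ.filter (fun j' => s j' = s j ∧ π (s j) j' ≤ π (s j) j), p j' := by
  simp [Ctime]




theorem dev_le (p : J → ℝ) (hp : ∀ j, 0 ≤ p j) (π : M → J → ℕ) (s : J → M) (j : J) (i : M)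
    (k : J) (hk : k ≠ j) (h : s k = i → π i k < π i j) :
    Ctime p (fun _ => (1:ℝ)) π (Function.update s j i) k ≤ Ctime p (fun _ => (1:ℝ)) π s k := by
  rw [Ctime_one, Ctime_one]
  apply Finset.sum_le_sum_of_subset_of_nonneg
  · intro a ha
    simp only [mem_filter, mem_univ, true_and, Function.update_of_ne hk] at ha ⊢
    by_cases haj : a = j
    · subst haj
      rw [Function.update_self] at ha
      have := h ha.1.symm
      rw [← ha.1] at ha
      omega
    · rwa [Function.update_of_ne haj] at ha
  · intros; exact hp _


theorem dev_self_ge (p : J → ℝ) (hp : ∀ j, 0 ≤ p j) (π : M → J → ℕ) (s : J → M) (j : J) (i : M)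
    (k : J) (hk : s k = i) (h : π i k < π i j) :
    p j + Ctime p (fun _ => (1:ℝ)) π s k ≤
      Ctime p (fun _ => (1:ℝ)) π (Function.update s j i) j := by
  rw [Ctime_one, Ctime_one, ← Finset.sum_insert]
  · apply Finset.sum_le_sum_of_subset_of_nonneg
    · intro a ha
      simp only [mem_insert, mem_filter, mem_univ, true_and, Function.update_self] at ha ⊢
      by_cases haj : a = j
      · subst haj; simp
      · rw [Function.update_of_ne haj]
        rcases ha with ha | ha
        · exact absurd ha haj
        · rw [hk] at ha
          exact ⟨ha.1, by omega⟩
    · intros; exact hp _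
  · simp only [mem_filter, mem_univ, true_and, hk]
    omega


theorem dev_self_ge' (p : J → ℝ) (hp : ∀ j, 0 ≤ p j) (π : M → J → ℕ) (s : J → M) (j : J) (i : M) :
    p j ≤ Ctime p (fun _ => (1:ℝ)) π (Function.update s j i) j := by
  rw [Ctime_one]
  apply Finset.single_le_sum (f := p) (fun a _ => hp a)
  simp


theorem dev_left (p : J → ℝ) (hp : ∀ j, 0 ≤ p j) (π : M → J → ℕ) (s : J → M) (j : J) (i : M)
    (k : J) (hk : k ≠ j) (hi : s j ≠ i) (hkj : s k = s j)
    (h : π (s j) j < π (s j) k) :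
    p j + Ctime p (fun _ => (1:ℝ)) π (Function.update s j i) k ≤
      Ctime p (fun _ => (1:ℝ)) π s k := by
  rw [Ctime_one, Ctime_one, ← Finset.sum_insert]
  · apply Finset.sum_le_sum_of_subset_of_nonneg
    · intro a ha
      simp only [mem_insert, mem_filter, mem_univ, true_and, Function.update_of_ne hk] at ha ⊢
      by_cases haj : a = j
      · subst haj; exact ⟨hkj.symm, by rw [hkj]; omega⟩
      · rcases ha with ha | ha
        · exact absurd ha haj
        · rwa [Function.update_of_ne haj] at ha
    · intros; exact hp _
  · simp only [mem_filter, mem_univ, true_and, Function.update_self, Function.update_of_ne hk]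
    rw [hkj]
    exact fun h => hi h.1.symm

end Generic

section Game

variable {X Y Z : Type*} [Fintype X] [Fintype Y] [Fintype Z]
  [DecidableEq X] [DecidableEq Y] [DecidableEq Z]

/-- The position class of a job on its own machine. -/
def posJ (T : Finset (X × Y × Z)) : Job3DM T → ℕ :=
  Sum.elim (fun _ => 1) (Sum.elim (fun _ => 2) (Sum.elim (fun _ => 0)
    (Sum.elim (fun _ => 3) (fun _ => 4))))

/-- The equilibrium profile. -/
def profJ (T : Finset (X × Y × Z)) (fy : Y → {t // t ∈ T}) (fz : Z → {t // t ∈ T})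
    (fd : DJob T → {t // t ∈ T}) : Job3DM T → {t // t ∈ T} :=
  Sum.elim fy (Sum.elim fz (Sum.elim fd (Sum.elim id id)))

theorem core_NE (T : Finset (X × Y × Z)) (P : {t // t ∈ T} → Prop)
    (fy : Y → {t // t ∈ T}) (fz : Z → {t // t ∈ T}) (fd : DJob T → {t // t ∈ T})
    (hy1 : ∀ y, P (fy y)) (hy2 : ∀ y, (fy y).1.2.1 = y) (hy3 : ∀ t, P t → fy t.1.2.1 = t)
    (hz1 : ∀ z, P (fz z)) (hz2 : ∀ z, (fz z).1.2.2 = z) (hz3 : ∀ t, P t → fz t.1.2.2 = t)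
    (hd1 : ∀ d, ¬ P (fd d)) (hd2 : ∀ d, (fd d).1.1 = d.1) (hdinj : Function.Injective fd)
    (hdsurj : ∀ t, ¬ P t → ∃ d, fd d = t)
    (π : {t // t ∈ T} → Job3DM T → ℕ)
    (hπinj : ∀ ℓ, Function.Injective (π ℓ))
    (hπblk : ∀ ℓ a b, blk T ℓ a < blk T ℓ b → π ℓ a < π ℓ b) :
    IsNE (pJob T) (fun _ => (1:ℝ)) π (profJ T fy fz fd) := by
  set s := profJ T fy fz fd with hs
  have sY : ∀ y, s (Sum.inl y) = fy y := fun _ => rfl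
  have sZ : ∀ z, s (Sum.inr (Sum.inl z)) = fz z := fun _ => rfl
  have sD : ∀ d, s (Sum.inr (Sum.inr (Sum.inl d))) = fd d := fun _ => rfl
  have sU : ∀ t, s (Sum.inr (Sum.inr (Sum.inr (Sum.inl t)))) = t := fun _ => rfl
  have sV : ∀ t, s (Sum.inr (Sum.inr (Sum.inr (Sum.inr t)))) = t := fun _ => rfl
  have pY : ∀ y, pJob T (Sum.inl y) = 1 := fun _ => rfl
  have pZ : ∀ z, pJob T (Sum.inr (Sum.inl z)) = 1 := fun _ => rfl
  have pD : ∀ d, pJob T (Sum.inr (Sum.inr (Sum.inl d))) = 2 := fun _ => rfl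
  have pU : ∀ t, pJob T (Sum.inr (Sum.inr (Sum.inr (Sum.inl t)))) = 1 := fun _ => rfl
  have pV : ∀ t, pJob T (Sum.inr (Sum.inr (Sum.inr (Sum.inr t)))) = 1 := fun _ => rfl
  have cY : ∀ y, posJ T (Sum.inl y) = 1 := fun _ => rfl
  have cZ : ∀ z, posJ T (Sum.inr (Sum.inl z)) = 2 := fun _ => rfl
  have cD : ∀ d, posJ T (Sum.inr (Sum.inr (Sum.inl d))) = 0 := fun _ => rfl
  have cU : ∀ t, posJ T (Sum.inr (Sum.inr (Sum.inr (Sum.inl t)))) = 3 := fun _ => rfl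
  have cV : ∀ t, posJ T (Sum.inr (Sum.inr (Sum.inr (Sum.inr t)))) = 4 := fun _ => rfl
  have hp : ∀ j, 0 ≤ pJob T j := by
    rintro (y | z | d | u | v) <;> simp [pJob]
  have hblk : ∀ a, blk T (s a) a = posJ T a := by
    rintro (y | z | d | u | v) <;> simp [blk, posJ, hs, profJ, hy2, hz2, hd2]
  have hcinj : ∀ a b, s a = s b → posJ T a = posJ T b → a = b := by
    rintro (y | z | d | u | v) (y' | z' | d' | u' | v') h1 h2 <;>
      simp only [sY, sZ, sD, sU, sV, cY, cZ, cD, cU, cV] at h1 h2 <;> first | omega | skip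
    · rw [← hy2 y, h1, hy2]
    · rw [← hz2 z, h1, hz2]
    · rw [hdinj h1]
    · rw [h1]
    · rw [h1]
  have hπc : ∀ ℓ a b, s a = ℓ → s b = ℓ → (π ℓ a ≤ π ℓ b ↔ posJ T a ≤ posJ T b) := by
    intro ℓ a b ha hb
    have h1 := hblk a
    have h2 := hblk b
    rw [ha] at h1
    rw [hb] at h2
    rcases lt_trichotomy (posJ T a) (posJ T b) with h | h | h
    · have := hπblk ℓ a b (by omega)
      exact ⟨fun _ => h.le, fun _ => this.le⟩
    · have := hcinj a b (ha.trans hb.symm) h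
      subst this
      simp
    · have := hπblk ℓ b a (by omega)
      constructor <;> intro <;> omega
  have hC : ∀ j, Ctime (pJob T) (fun _ => (1:ℝ)) π s j =
      ∑ j' ∈ univ.filter (fun j' => s j' = s j ∧ posJ T j' ≤ posJ T j), pJob T j' := by
    intro j
    rw [Ctime_one]
    apply Finset.sum_congr _ (fun _ _ => rfl)
    ext a
    simp only [mem_filter, mem_univ, true_and]
    constructor
    · rintro ⟨h1, h2⟩
      exact ⟨h1, (hπc _ _ _ h1 rfl).1 h2⟩
    · rintro ⟨h1, h2⟩
      exact ⟨h1, (hπc _ _ _ h1 rfl).2 h2⟩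
  -- the content of a matched machine and of an unmatched one
  have hsetP : ∀ t, P t → ∀ a, s a = t ↔ a = Sum.inl t.1.2.1 ∨ a = Sum.inr (Sum.inl t.1.2.2) ∨
      a = Sum.inr (Sum.inr (Sum.inr (Sum.inl t))) ∨
      a = Sum.inr (Sum.inr (Sum.inr (Sum.inr t))) := by
    intro t ht
    rintro (y | z | d | u | v) <;> simp only [sY, sZ, sD, sU, sV] <;> simp
    · exact ⟨fun h => by rw [← h, hy2], fun h => by rw [h, hy3 t ht]⟩
    · exact ⟨fun h => by rw [← h, hz2], fun h => by rw [h, hz3 t ht]⟩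
    · rintro rfl; exact hd1 _ ht
  have hsetN : ∀ d a, s a = fd d ↔ a = Sum.inr (Sum.inr (Sum.inl d)) ∨
      a = Sum.inr (Sum.inr (Sum.inr (Sum.inl (fd d)))) ∨
      a = Sum.inr (Sum.inr (Sum.inr (Sum.inr (fd d)))) := by
    intro d
    rintro (y | z | d' | u | v) <;> simp only [sY, sZ, sD, sU, sV] <;> simp
    · intro h; exact hd1 d (h ▸ hy1 y)
    · intro h; exact hd1 d (h ▸ hz1 z)
    · exact hdinj.eq_iff
  have CY : ∀ y, Ctime (pJob T) (fun _ => (1:ℝ)) π s (Sum.inl y) = 1 := by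
    intro y
    have : univ.filter (fun j' => s j' = s (Sum.inl y) ∧ posJ T j' ≤ posJ T (Sum.inl y)) =
        {Sum.inl y} := by
      ext a
      simp only [mem_filter, mem_univ, true_and, mem_singleton, sY, hsetP _ (hy1 y), hy2]
      constructor
      · rintro ⟨rfl | rfl | rfl | rfl, h⟩ <;> simp only [cY, cZ, cD, cU, cV] at h <;>
          first | omega | simp
      · rintro rfl; simp
    rw [hC, this, Finset.sum_singleton, pY]
  have CZ : ∀ z, Ctime (pJob T) (fun _ => (1:ℝ)) π s (Sum.inr (Sum.inl z)) = 2 := by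
    intro z
    have : univ.filter (fun j' => s j' = s (Sum.inr (Sum.inl z)) ∧
        posJ T j' ≤ posJ T (Sum.inr (Sum.inl z))) =
        {Sum.inl (fz z).1.2.1, Sum.inr (Sum.inl z)} := by
      ext a
      simp only [mem_filter, mem_univ, true_and, mem_singleton, mem_insert, sZ,
        hsetP _ (hz1 z), hz2]
      constructor
      · rintro ⟨rfl | rfl | rfl | rfl, h⟩ <;> simp only [cY, cZ, cD, cU, cV] at h <;>
          first | omega | simp
      · rintro (rfl | rfl) <;> simp [cY, cZ]
    rw [hC, this, Finset.sum_pair (by simp), pY, pZ]; norm_num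
  have CD : ∀ d, Ctime (pJob T) (fun _ => (1:ℝ)) π s (Sum.inr (Sum.inr (Sum.inl d))) = 2 := by
    intro d
    have : univ.filter (fun j' => s j' = s (Sum.inr (Sum.inr (Sum.inl d))) ∧
        posJ T j' ≤ posJ T (Sum.inr (Sum.inr (Sum.inl d)))) =
        {Sum.inr (Sum.inr (Sum.inl d))} := by
      ext a
      simp only [mem_filter, mem_univ, true_and, mem_singleton, sD, hsetN]
      constructor
      · rintro ⟨rfl | rfl | rfl, h⟩ <;> simp only [cY, cZ, cD, cU, cV] at h <;>
          first | omega | simp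
      · rintro rfl; simp
    rw [hC, this, Finset.sum_singleton, pD]
  have CU : ∀ t, Ctime (pJob T) (fun _ => (1:ℝ)) π s
      (Sum.inr (Sum.inr (Sum.inr (Sum.inl t)))) = 3 := by
    intro t
    by_cases ht : P t
    · have : univ.filter (fun j' => s j' = s (Sum.inr (Sum.inr (Sum.inr (Sum.inl t)))) ∧
          posJ T j' ≤ posJ T (Sum.inr (Sum.inr (Sum.inr (Sum.inl t))))) =
          {Sum.inl t.1.2.1, Sum.inr (Sum.inl t.1.2.2),
            Sum.inr (Sum.inr (Sum.inr (Sum.inl t)))} := by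
        ext a
        simp only [mem_filter, mem_univ, true_and, mem_singleton, mem_insert, sU, hsetP _ ht]
        constructor
        · rintro ⟨rfl | rfl | rfl | rfl, h⟩ <;> simp only [cY, cZ, cD, cU, cV] at h <;>
            first | omega | simp
        · rintro (rfl | rfl | rfl) <;> simp [cY, cZ, cU]
      rw [hC, this, Finset.sum_insert (by simp), Finset.sum_pair (by simp), pY, pZ, pU]; norm_num
    · obtain ⟨d, rfl⟩ := hdsurj t ht
      have : univ.filter (fun j' => s j' = s (Sum.inr (Sum.inr (Sum.inr (Sum.inl (fd d))))) ∧
          posJ T j' ≤ posJ T (Sum.inr (Sum.inr (Sum.inr (Sum.inl (fd d)))))) =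
          {Sum.inr (Sum.inr (Sum.inl d)), Sum.inr (Sum.inr (Sum.inr (Sum.inl (fd d))))} := by
        ext a
        simp only [mem_filter, mem_univ, true_and, mem_singleton, mem_insert, sU, hsetN]
        constructor
        · rintro ⟨rfl | rfl | rfl, h⟩ <;> simp only [cY, cZ, cD, cU, cV] at h <;>
            first | omega | simp
        · rintro (rfl | rfl) <;> simp [cD, cU]
      rw [hC, this, Finset.sum_pair (by simp), pD, pU]; norm_num
  have CV : ∀ t, Ctime (pJob T) (fun _ => (1:ℝ)) π s
      (Sum.inr (Sum.inr (Sum.inr (Sum.inr t)))) = 4 := by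
    intro t
    have h1 : univ.filter (fun j' => s j' = s (Sum.inr (Sum.inr (Sum.inr (Sum.inr t)))) ∧
          posJ T j' ≤ posJ T (Sum.inr (Sum.inr (Sum.inr (Sum.inr t))))) =
        insert (Sum.inr (Sum.inr (Sum.inr (Sum.inr t))))
          (univ.filter (fun j' => s j' = s (Sum.inr (Sum.inr (Sum.inr (Sum.inl t)))) ∧
          posJ T j' ≤ posJ T (Sum.inr (Sum.inr (Sum.inr (Sum.inl t)))))) := by
      ext a
      simp only [mem_filter, mem_univ, true_and, mem_insert, sU, sV, cU, cV]
      rcases a with (y | z | d | u | v) <;>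
        simp only [sY, sZ, sD, sU, sV, cY, cZ, cD, cU, cV] <;> simp
    rw [hC, h1, Finset.sum_insert (by simp [cU, cV]), ← hC, CU, pV]; norm_num
  intro j i
  by_cases hi : s j = i
  · subst hi
    rintro (h | ⟨_, h⟩) <;> simp [Function.update_eq_self] at h
  rcases j with (y | z | d | u | v)
  · -- job of `Y`
    refine not_beneficial_aux _ _ _ _ _ _ id Function.injective_id rfl ?_ ?_
    · have := dev_self_ge' _ hp π s (Sum.inl y) i
      rwa [CY, ← pY y]
    · intro k hk hck
      apply dev_le _ hp _ _ _ _ _ hk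
      rintro rfl
      apply hπblk
      rw [hblk]
      rw [sY] at hi
      rcases k with (y' | z' | d' | u' | v') <;> simp only [CY, CZ, CD, CU, CV] at hck <;>
        norm_num at hck
      have : y ≠ y' := fun h => hk (by rw [h])
      simp [blk, sY, cY, hy2, this]
  · -- job of `Z`
    have hiz : ∀ t, s (Sum.inr (Sum.inl z)) ≠ t → 2 ≤ blk T t (Sum.inr (Sum.inl z)) := by
      intro t _
      simp only [blk]; split_ifs <;> omega
    refine not_beneficial_aux _ _ _ _ _ _ id Function.injective_id rfl ?_ ?_
    · rw [CZ]
      by_cases hPi : P i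
      · have h1 : s (Sum.inl i.1.2.1) = i := by rw [sY, hy3 i hPi]
        have := dev_self_ge _ hp π s (Sum.inr (Sum.inl z)) i _ h1 (hπblk _ _ _ (by
          have h2 := hblk (Sum.inl i.1.2.1)
          rw [h1, cY] at h2
          have := hiz i hi
          omega))
        rw [CY, pZ] at this
        linarith
      · obtain ⟨d, rfl⟩ := hdsurj i hPi
        have := dev_self_ge _ hp π s (Sum.inr (Sum.inl z)) _ _ (sD d) (hπblk _ _ _ (by
          have h2 := hblk (Sum.inr (Sum.inr (Sum.inl d)))
          rw [sD, cD] at h2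
          have := hiz _ hi
          omega))
        rw [CD, pZ] at this
        linarith
    · intro k hk hck
      apply dev_le _ hp _ _ _ _ _ hk
      rintro rfl
      apply hπblk
      rw [hblk]
      have h2 := hiz _ hi
      rcases k with (y' | z' | d' | u' | v') <;> simp only [CY, CZ, CD, CU, CV] at hck <;>
        norm_num at hck
      · rw [cY]; omega
      · have : z ≠ z' := fun h => hk (by rw [h])
        simp [blk, sZ, cZ, hz2, this]
      · rw [cD]; omega
  · -- job of `D`
    have hcge : Ctime (pJob T) (fun _ => (1:ℝ)) π s (Sum.inr (Sum.inr (Sum.inl d))) ≤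
        Ctime (pJob T) (fun _ => (1:ℝ)) π
          (devJ s (Sum.inr (Sum.inr (Sum.inl d))) i)
          (Sum.inr (Sum.inr (Sum.inl d))) := by
      have := dev_self_ge' _ hp π s (Sum.inr (Sum.inr (Sum.inl d))) i
      rwa [CD, ← pD d]
    have hleft : ∀ k, posJ T k ≠ 0 → s k = fd d →
        2 + Ctime (pJob T) (fun _ => (1:ℝ)) π
          (devJ s (Sum.inr (Sum.inr (Sum.inl d))) i) k ≤
          Ctime (pJob T) (fun _ => (1:ℝ)) π s k := by
      intro k hk hsk
      have hne : k ≠ Sum.inr (Sum.inr (Sum.inl d)) := by rintro rfl; exact hk rfl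
      have := dev_left _ hp π s _ i k hne hi (by rw [hsk, sD]) (by
        apply hπblk
        have h1 := hblk k
        rw [hblk, sD, ← hsk, h1, cD]
        omega)
      rwa [pD] at this
    have hUl := hleft (Sum.inr (Sum.inr (Sum.inr (Sum.inl (fd d))))) (by rw [cU]; norm_num) (sU _)
    have hVl := hleft (Sum.inr (Sum.inr (Sum.inr (Sum.inr (fd d))))) (by rw [cV]; norm_num) (sV _)
    rw [CU] at hUl
    rw [CV] at hVl
    by_cases hdi : d.1 = i.1.1
    · by_cases hPi : P i
      · -- matched machine
        refine not_beneficial_aux _ _ _ _ _ _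
          (⇑(Equiv.swap (Sum.inl i.1.2.1) (Sum.inr (Sum.inr (Sum.inr (Sum.inl (fd d))))) *
            Equiv.swap (Sum.inr (Sum.inl i.1.2.2))
              (Sum.inr (Sum.inr (Sum.inr (Sum.inr (fd d))))) : Equiv.Perm (Job3DM T))) (Equiv.injective _) ?_ hcge ?_
        · simp [Equiv.swap_apply_def]
        · intro k hk hck
          by_cases hki : s k = i
          · rw [hsetP i hPi] at hki
            rcases hki with rfl | rfl | rfl | rfl
            · rw [CY]
              simp only [Equiv.Perm.coe_mul, Function.comp_apply]
              rw [Equiv.swap_apply_of_ne_of_ne (a := Sum.inr (Sum.inl i.1.2.2)) (by simp)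
                (by simp), Equiv.swap_apply_left]
              linarith
            · rw [CZ]
              simp only [Equiv.Perm.coe_mul, Function.comp_apply]
              rw [Equiv.swap_apply_left, Equiv.swap_apply_of_ne_of_ne (by simp) (by simp)]
              linarith
            · rw [CU, CD] at hck; norm_num at hck
            · rw [CV, CD] at hck; norm_num at hck
          · have h1 : k ≠ Sum.inl i.1.2.1 := by
              rintro rfl; exact hki (by rw [hsetP i hPi]; simp)
            have h2 : k ≠ Sum.inr (Sum.inl i.1.2.2) := by
              rintro rfl; exact hki (by rw [hsetP i hPi]; simp)
            have h3 : k ≠ Sum.inr (Sum.inr (Sum.inr (Sum.inl (fd d)))) := by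
              rintro rfl; rw [CU, CD] at hck; norm_num at hck
            have h4 : k ≠ Sum.inr (Sum.inr (Sum.inr (Sum.inr (fd d)))) := by
              rintro rfl; rw [CV, CD] at hck; norm_num at hck
            simp only [Equiv.Perm.coe_mul, Function.comp_apply]
            rw [Equiv.swap_apply_of_ne_of_ne h2 h4, Equiv.swap_apply_of_ne_of_ne h1 h3]
            exact dev_le _ hp _ _ _ _ _ hk (fun h => absurd h hki)
      · obtain ⟨e, rfl⟩ := hdsurj i hPi
        have hed : e ≠ d := by rintro rfl; exact hi rfl
        refine not_beneficial_aux _ _ _ _ _ _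
          (Equiv.swap (Sum.inr (Sum.inr (Sum.inl e)))
            (Sum.inr (Sum.inr (Sum.inr (Sum.inl (fd d)))))) (Equiv.injective _) ?_ hcge ?_
        · simp [Equiv.swap_apply_def, hed.symm]
        · intro k hk hck
          by_cases hki : s k = fd e
          · rw [hsetN] at hki
            rcases hki with rfl | rfl | rfl
            · rw [CD, Equiv.swap_apply_left]
              linarith
            · rw [CU, CD] at hck; norm_num at hck
            · rw [CV, CD] at hck; norm_num at hck
          · have h1 : k ≠ Sum.inr (Sum.inr (Sum.inl e)) := by
              rintro rfl; exact hki (by rw [hsetN]; simp)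
            have h3 : k ≠ Sum.inr (Sum.inr (Sum.inr (Sum.inl (fd d)))) := by
              rintro rfl; rw [CU, CD] at hck; norm_num at hck
            rw [Equiv.swap_apply_of_ne_of_ne h1 h3]
            exact dev_le _ hp _ _ _ _ _ hk (fun h => absurd h hki)
    · refine not_beneficial_aux _ _ _ _ _ _ id Function.injective_id rfl hcge ?_
      intro k hk hck
      apply dev_le _ hp _ _ _ _ _ hk
      rintro rfl
      apply hπblk
      rw [hblk]
      have h6 : blk T (s k) (Sum.inr (Sum.inr (Sum.inl d))) = 6 := by simp [blk, hdi]
      rw [h6]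
      rcases k with (y' | z' | d' | u' | v') <;> simp only [cY, cZ, cD, cU, cV] <;> omega
  · -- job of `U`
    have hbu : ∀ t, blk T t (Sum.inr (Sum.inr (Sum.inr (Sum.inl u)))) = 3 := fun _ => rfl
    have hcge : Ctime (pJob T) (fun _ => (1:ℝ)) π s
        (Sum.inr (Sum.inr (Sum.inr (Sum.inl u)))) ≤
        Ctime (pJob T) (fun _ => (1:ℝ)) π
          (devJ s (Sum.inr (Sum.inr (Sum.inr (Sum.inl u)))) i)
          (Sum.inr (Sum.inr (Sum.inr (Sum.inl u)))) := by
      rw [CU]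
      by_cases hPi : P i
      · have h1 : s (Sum.inr (Sum.inl i.1.2.2)) = i := by rw [sZ, hz3 i hPi]
        have := dev_self_ge _ hp π s (Sum.inr (Sum.inr (Sum.inr (Sum.inl u)))) i _ h1
          (hπblk _ _ _ (by
            have h2 := hblk (Sum.inr (Sum.inl i.1.2.2))
            rw [h1, cZ] at h2
            rw [hbu]
            omega))
        rw [CZ, pU] at this
        linarith
      · obtain ⟨d, rfl⟩ := hdsurj i hPi
        have := dev_self_ge _ hp π s (Sum.inr (Sum.inr (Sum.inr (Sum.inl u)))) _ _ (sD d)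
          (hπblk _ _ _ (by
            have h2 := hblk (Sum.inr (Sum.inr (Sum.inl d)))
            rw [sD, cD] at h2
            rw [hbu]
            omega))
        rw [CD, pU] at this
        linarith
    have hiu : i ≠ u := fun h => hi h.symm
    have hlow : ∀ k, s k = i → posJ T k < 3 →
        π i k < π i (Sum.inr (Sum.inr (Sum.inr (Sum.inl u)))) := by
      rintro k rfl hk
      apply hπblk
      rwa [hblk, hbu]
    have hpos : ∀ k, Ctime (pJob T) (fun _ => (1:ℝ)) π s k ≤ 3 → s k = i →
        k ≠ Sum.inr (Sum.inr (Sum.inr (Sum.inl i))) → posJ T k < 3 := by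
      intro k hck hki hk
      rcases k with (y' | z' | d' | u' | v')
      · rw [cY]; omega
      · rw [cZ]; omega
      · rw [cD]; omega
      · rw [sU] at hki; exact absurd (by rw [hki]) hk
      · rw [CV] at hck; norm_num at hck
    by_cases hlt : π i (Sum.inr (Sum.inr (Sum.inr (Sum.inl i)))) <
        π i (Sum.inr (Sum.inr (Sum.inr (Sum.inl u))))
    · refine not_beneficial_aux _ _ _ _ _ _ id Function.injective_id rfl hcge ?_
      intro k hk hck
      rw [CU] at hck
      apply dev_le _ hp _ _ _ _ _ hk
      intro hki
      by_cases hku : k = Sum.inr (Sum.inr (Sum.inr (Sum.inl i)))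
      · rwa [hku]
      · exact hlow k hki (hpos k hck hki hku)
    · refine not_beneficial_aux _ _ _ _ _ _
          (Equiv.swap (Sum.inr (Sum.inr (Sum.inr (Sum.inl i))))
            (Sum.inr (Sum.inr (Sum.inr (Sum.inr u))))) (Equiv.injective _) ?_ hcge ?_
      · simp [Equiv.swap_apply_def, hiu.symm]
      · intro k hk hck
        rw [CU] at hck
        by_cases hku : k = Sum.inr (Sum.inr (Sum.inr (Sum.inl i)))
        · subst hku
          rw [Equiv.swap_apply_left, CU]
          have := dev_left _ hp π s (Sum.inr (Sum.inr (Sum.inr (Sum.inl u)))) i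
            (Sum.inr (Sum.inr (Sum.inr (Sum.inr u)))) (by simp) hi rfl (by
              apply hπblk
              simp [blk, sU])
          rw [pU, CV] at this
          linarith
        · have h3 : k ≠ Sum.inr (Sum.inr (Sum.inr (Sum.inr u))) := by
            rintro rfl; rw [CV] at hck; norm_num at hck
          rw [Equiv.swap_apply_of_ne_of_ne hku h3]
          apply dev_le _ hp _ _ _ _ _ hk
          intro hki
          exact hlow k hki (hpos k hck hki hku)
  · -- job of `V`
    have hiv : v ≠ i := fun h => hi h
    have hbv : blk T i (Sum.inr (Sum.inr (Sum.inr (Sum.inr v)))) = 5 := by simp [blk, hiv]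
    have hlow : ∀ k, s k = i →
        π i k < π i (Sum.inr (Sum.inr (Sum.inr (Sum.inr v)))) := by
      rintro k rfl
      apply hπblk
      rw [hblk, hbv]
      rcases k with (y' | z' | d' | u' | v') <;> simp only [cY, cZ, cD, cU, cV] <;> omega
    refine not_beneficial_aux _ _ _ _ _ _ id Function.injective_id rfl ?_ ?_
    · have := dev_self_ge _ hp π s _ i _ (sU i) (hlow _ (sU i))
      rw [CU, pV] at this
      rw [CV]
      linarith
    · intro k hk _
      exact dev_le _ hp _ _ _ _ _ hk (hlow k)

end Game

/-- If the 3DM-3 instance `T` has a perfect matching, then the game `G_T` admits a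
pure Nash equilibrium. -/
theorem matching_implies_NE
    (n : ℕ) (T : Finset (X × Y × Z))
    (hX : Fintype.card X = n) (hY : Fintype.card Y = n) (hZ : Fintype.card Z = n)
    (hTn : n ≤ T.card)
    (hoccX : ∀ x : X, (T.filter (fun t => t.1 = x)).card = 2 ∨
      (T.filter (fun t => t.1 = x)).card = 3)
    (hoccY : ∀ y : Y, (T.filter (fun t => t.2.1 = y)).card = 2 ∨
      (T.filter (fun t => t.2.1 = y)).card = 3)
    (hoccZ : ∀ z : Z, (T.filter (fun t => t.2.2 = z)).card = 2 ∨
      (T.filter (fun t => t.2.2 = z)).card = 3)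
    (ordY : Y → ℕ) (ordZ : Z → ℕ) (ordD : DJob T → ℕ) (ordU ordV : {t // t ∈ T} → ℕ)
    (hordY : Function.Injective ordY) (hordZ : Function.Injective ordZ)
    (hordD : Function.Injective ordD) (hordU : Function.Injective ordU)
    (hordV : Function.Injective ordV)
    (π : {t // t ∈ T} → Job3DM T → ℕ)
    (hπinj : ∀ ℓ, Function.Injective (π ℓ))
    (hπblk : ∀ ℓ a b, blk T ℓ a < blk T ℓ b → π ℓ a < π ℓ b)
    (hπord : ∀ ℓ a b, blk T ℓ a = blk T ℓ b →
      withinOrd T ordY ordZ ordD ordU ordV a b → π ℓ a < π ℓ b)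
    (hmatch : ∃ T' ⊆ T, T'.card = n ∧
      (∀ x : X, (T'.filter (fun t => t.1 = x)).card = 1) ∧
      (∀ y : Y, (T'.filter (fun t => t.2.1 = y)).card = 1) ∧
      (∀ z : Z, (T'.filter (fun t => t.2.2 = z)).card = 1)) :
    ∃ s : Job3DM T → {t // t ∈ T}, IsNE (pJob T) (fun _ => (1:ℝ)) π s := by
  obtain ⟨T', hsub, -, hmx, hmy, hmz⟩ := hmatch
  have ey : ∀ y : Y, ∃ t : {t // t ∈ T}, t.1 ∈ T' ∧ t.1.2.1 = y ∧
      ∀ t' ∈ T', t'.2.1 = y → t' = t.1 := by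
    intro y
    obtain ⟨t, ht⟩ := Finset.card_eq_one.1 (hmy y)
    have h1 : t ∈ T' ∧ t.2.1 = y := by
      have : t ∈ T'.filter (fun t => t.2.1 = y) := by rw [ht]; simp
      simpa using this
    refine ⟨⟨t, hsub h1.1⟩, h1.1, h1.2, fun t' h2 h3 => ?_⟩
    have : t' ∈ T'.filter (fun t => t.2.1 = y) := by simp [h2, h3]
    rw [ht] at this
    simpa using this
  have ez : ∀ z : Z, ∃ t : {t // t ∈ T}, t.1 ∈ T' ∧ t.1.2.2 = z ∧
      ∀ t' ∈ T', t'.2.2 = z → t' = t.1 := by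
    intro z
    obtain ⟨t, ht⟩ := Finset.card_eq_one.1 (hmz z)
    have h1 : t ∈ T' ∧ t.2.2 = z := by
      have : t ∈ T'.filter (fun t => t.2.2 = z) := by rw [ht]; simp
      simpa using this
    refine ⟨⟨t, hsub h1.1⟩, h1.1, h1.2, fun t' h2 h3 => ?_⟩
    have : t' ∈ T'.filter (fun t => t.2.2 = z) := by simp [h2, h3]
    rw [ht] at this
    simpa using this
  choose fy hy1 hy2 hy3 using ey
  choose fz hz1 hz2 hz3 using ez
  have hcard : ∀ x : X, (T.filter (fun t => t.1 = x) \ T'.filter (fun t => t.1 = x)).card =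
      (T.filter (fun t => t.1 = x)).card - 1 := by
    intro x
    rw [Finset.card_sdiff_of_subset (Finset.filter_subset_filter _ hsub), hmx x]
  let e := fun x : X => Finset.equivFinOfCardEq (hcard x)
  have he : ∀ d : DJob T, ((e d.1).symm d.2).1 ∈ T ∧ ((e d.1).symm d.2).1.1 = d.1 ∧
      ((e d.1).symm d.2).1 ∉ T' := by
    intro d
    have h := ((e d.1).symm d.2).2
    simp only [mem_sdiff, mem_filter, not_and] at h
    exact ⟨h.1.1, h.1.2, fun h' => h.2 h' h.1.2⟩
  refine ⟨profJ T fy fz (fun d => ⟨((e d.1).symm d.2).1, (he d).1⟩),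
    core_NE T (fun t => t.1 ∈ T') fy fz _ hy1 hy2 ?_ hz1 hz2 ?_ ?_ ?_ ?_ ?_ π hπinj hπblk⟩
  · intro t ht
    exact Subtype.ext (hy3 _ t.1 ht rfl).symm
  · intro t ht
    exact Subtype.ext (hz3 _ t.1 ht rfl).symm
  · intro d; exact (he d).2.2
  · intro d; exact (he d).2.1
  · rintro ⟨x, a⟩ ⟨x', a'⟩ h
    have h1 : ((e x).symm a).1 = ((e x').symm a').1 := congrArg Subtype.val h
    have hx : x = x' := by
      have h2 := (he ⟨x, a⟩).2.1
      have h3 := (he ⟨x', a'⟩).2.1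
      simp only at h2 h3
      rw [← h2, h1, h3]
    subst hx
    have := (e x).symm.injective (Subtype.ext h1)
    rw [this]
  · intro t ht
    refine ⟨⟨t.1.1, e t.1.1 ⟨t.1, ?_⟩⟩, ?_⟩
    · simp only [mem_sdiff, mem_filter]
      exact ⟨⟨t.2, trivial⟩, fun h => ht h.1⟩
    · apply Subtype.ext
      simp
end
end

section
/- Let s be a profile of a scheduling game with rank-based utilities in which all machines are identical (all speeds 1) and all jobs are unit jobs, and suppose s is stable against cost-reducing deviations. Then a job j assigned to machine M_i has a beneficial deviation if and only if both of the following hold: (1) j is processed last on M_i, i.e., every other job j' assigned to M_i satisfies π_i(j') < π_i(j); and (2) there exists a machine M_z ≠ M_i and a job j' assigned to M_z with C_{j'}(s) = C_j(s) and π_z(j) < π_z(j'). -/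
open Finset
open scoped Classical

noncomputable section

variable {J M : Type*} [Fintype J]

/-- `s` is stable against cost-reducing deviations. -/
def StableCost (p : J → ℝ) (r : M → ℝ) (π : M → J → ℕ) (s : J → M) : Prop :=
  ∀ j i, ¬ Ctime p r π (Function.update s j i) j < Ctime p r π s j

namespace BenIff

lemma pos_image {α : Type*} (A : Finset α) (f : α → ℕ) (hf : Function.Injective f) :
    A.image (fun a => (A.filter (fun b => f b ≤ f a)).card) = Finset.Icc 1 A.card ∧
    Set.InjOn (fun a => (A.filter (fun b => f b ≤ f a)).card) A := by
  have hlt : ∀ a ∈ A, ∀ b ∈ A, f a < f b →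
      (A.filter (fun x => f x ≤ f a)).card < (A.filter (fun x => f x ≤ f b)).card := by
    intro a ha b hb hab
    apply Finset.card_lt_card
    rw [Finset.ssubset_iff_of_subset]
    · exact ⟨b, by simp [hb], by simp [hab]⟩
    · intro x hx
      simp only [Finset.mem_filter] at hx ⊢
      exact ⟨hx.1, by omega⟩
  have hinj : Set.InjOn (fun a => (A.filter (fun b => f b ≤ f a)).card) A := by
    intro a ha b hb hab
    simp only at hab
    by_contra hne
    rcases lt_or_gt_of_ne (fun h => hne (hf h)) with h | h
    · have := hlt a ha b hb h
      omega
    · have := hlt b hb a ha h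
      omega
  refine ⟨?_, hinj⟩
  apply Finset.eq_of_subset_of_card_le
  · intro k hk
    obtain ⟨a, ha, rfl⟩ := Finset.mem_image.1 hk
    rw [Finset.mem_Icc]
    refine ⟨Finset.card_pos.2 ⟨a, by simp [ha]⟩, Finset.card_filter_le _ _⟩
  · rw [Finset.card_image_of_injOn hinj]
    simp

lemma pos_count {α : Type*} (A : Finset α) (f : α → ℕ) (hf : Function.Injective f) (t : ℕ) :
    (A.filter (fun a => (A.filter (fun b => f b ≤ f a)).card ≤ t)).card = min A.card t := by
  obtain ⟨him, hinj⟩ := pos_image A f hf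
  have h1 : ((A.image (fun a => (A.filter (fun b => f b ≤ f a)).card)).filter (· ≤ t)).card
      = (A.filter (fun a => (A.filter (fun b => f b ≤ f a)).card ≤ t)).card := by
    rw [Finset.filter_image]
    apply Finset.card_image_of_injOn
    exact hinj.mono (by intro x hx; simp at hx ⊢; exact hx.1)
  rw [← h1, him]
  have : (Finset.Icc 1 A.card).filter (· ≤ t) = Finset.Icc 1 (min A.card t) := by
    ext x
    simp
    omega
  rw [this]
  simp

variable {m : ℕ}

def Pos (π : Fin m → J → ℕ) (s : J → Fin m) (j : J) : ℕ :=
  (univ.filter (fun j' => s j' = s j ∧ π (s j) j' ≤ π (s j) j)).card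

def Load (s : J → Fin m) (i : Fin m) : ℕ := (univ.filter (fun j' => s j' = i)).card

def Cnt (π : Fin m → J → ℕ) (s : J → Fin m) (t : ℕ) : ℕ :=
  (univ.filter (fun j' => Pos π s j' ≤ t)).card

lemma ctime_eq (π : Fin m → J → ℕ) (s : J → Fin m) (j : J) :
    Ctime (fun _ => (1:ℝ)) (fun _ => (1:ℝ)) π s j = (Pos π s j : ℝ) := by
  simp [Ctime, Pos]
  congr!

lemma pos_eq (π : Fin m → J → ℕ) (s : J → Fin m) (j : J) :
    Pos π s j = ((univ.filter (fun j' => s j' = s j)).filter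
      (fun j' => π (s j) j' ≤ π (s j) j)).card := by
  rw [Finset.filter_filter, Pos]

lemma pos_pos (π : Fin m → J → ℕ) (s : J → Fin m) (j : J) : 1 ≤ Pos π s j :=
  Finset.card_pos.2 ⟨j, by simp⟩

lemma pos_le (π : Fin m → J → ℕ) (s : J → Fin m) (j : J) : Pos π s j ≤ Load s (s j) := by
  rw [pos_eq]
  exact Finset.card_filter_le _ _

lemma cnt_eq (π : Fin m → J → ℕ) (hπ : ∀ i, Function.Injective (π i)) (s : J → Fin m) (t : ℕ) :
    Cnt π s t = ∑ i, min (Load s i) t := by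
  unfold Cnt
  rw [Finset.card_eq_sum_card_fiberwise (f := s) (t := univ) (by intro x _; simp)]
  apply Finset.sum_congr rfl
  intro i _
  rw [Load, ← pos_count _ (π i) (hπ i) t]
  congr 1
  ext x
  simp only [Finset.mem_filter, Finset.mem_univ, true_and]
  constructor
  · rintro ⟨h, rfl⟩
    rw [pos_eq] at h
    exact ⟨rfl, h⟩
  · rintro ⟨rfl, h⟩
    rw [pos_eq]
    exact ⟨h, rfl⟩

lemma rank_eq (π : Fin m → J → ℕ) (s : J → Fin m) (j : J) :
    rankOf (fun _ => (1:ℝ)) (fun _ => (1:ℝ)) π s j =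
      ((Cnt π s (Pos π s j - 1) + Cnt π s (Pos π s j) + 1 : ℕ) : ℝ) / 2 := by
  have h1 : (univ.filter (fun j' => Pos π s j' < Pos π s j)).card = Cnt π s (Pos π s j - 1) := by
    unfold Cnt
    congr 1
    ext x
    have := pos_pos π s j
    simp
    omega
  have h2 : Cnt π s (Pos π s j) = (univ.filter (fun j' => Pos π s j' < Pos π s j)).card +
      (univ.filter (fun j' => Pos π s j' = Pos π s j)).card := by
    rw [← Finset.card_union_of_disjoint]
    · unfold Cnt
      congr 1
      ext x
      simp
      omega
    · rw [Finset.disjoint_filter]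
      intro x _ h
      omega
  unfold rankOf
  simp only [ctime_eq, Nat.cast_lt, Nat.cast_inj]
  rw [h2, ← h1]
  push_cast
  ring

lemma load_split (s : J → Fin m) (i z : Fin m) (h : z ≠ i) (t : ℕ) :
    ∑ k, min (Load s k) t = ∑ k ∈ (univ.erase i).erase z, min (Load s k) t
      + min (Load s i) t + min (Load s z) t := by
  rw [← Finset.sum_erase_add univ _ (Finset.mem_univ i),
    ← Finset.sum_erase_add (univ.erase i) _ (by simp [h] : z ∈ univ.erase i)]
  ring

lemma load_upd_i (s : J → Fin m) (j : J) (z : Fin m) (h : z ≠ s j) :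
    Load (Function.update s j z) (s j) + 1 = Load s (s j) := by
  unfold Load
  rw [← Finset.card_erase_add_one (s := univ.filter (fun j' => s j' = s j)) (a := j) (by simp)]
  congr 2
  ext x
  by_cases hx : x = j
  · subst hx; simp [h]
  · simp [hx]

lemma load_upd_z (s : J → Fin m) (j : J) (z : Fin m) (h : z ≠ s j) :
    Load (Function.update s j z) z = Load s z + 1 := by
  unfold Load
  rw [← Finset.card_insert_of_notMem (s := univ.filter (fun j' => s j' = z)) (a := j)
    (by simpa using h.symm)]
  congr 1
  ext x
  by_cases hx : x = j
  · subst hx; simp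
  · simp [hx]

lemma load_upd_o (s : J → Fin m) (j : J) (z k : Fin m) (h : k ≠ s j) (h' : k ≠ z) :
    Load (Function.update s j z) k = Load s k := by
  unfold Load
  congr 1
  ext x
  by_cases hx : x = j
  · subst hx; simp [h.symm, h'.symm]
  · simp [hx]

lemma pos_upd (π : Fin m → J → ℕ) (hπ : ∀ i, Function.Injective (π i)) (s : J → Fin m)
    (j : J) (z : Fin m) (h : z ≠ s j) :
    Pos π (Function.update s j z) j =
      (univ.filter (fun b => s b = z ∧ π z b < π z j)).card + 1 := by
  unfold Pos
  rw [← Finset.card_insert_of_notMem (a := j) (by simp)]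
  congr 1
  ext x
  by_cases hx : x = j
  · subst hx; simp
  · have : π z x ≠ π z j := fun e => hx (hπ z e)
    simp [hx]
    intro _
    omega

lemma last_iff (π : Fin m → J → ℕ) (hπ : ∀ i, Function.Injective (π i)) (s : J → Fin m)
    (j : J) : (∀ j', j' ≠ j → s j' = s j → π (s j) j' < π (s j) j) ↔
      Pos π s j = Load s (s j) := by
  rw [pos_eq, Load, Finset.card_filter_eq_iff]
  constructor
  · intro h x hx
    by_cases e : x = j
    · rw [e]
    · exact (h x e (by simpa using hx)).le
  · intro h x hx hs
    exact lt_of_le_of_ne (h x (by simpa using hs)) (fun e => hx (hπ _ e))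

lemma exists_pos (π : Fin m → J → ℕ) (hπ : ∀ i, Function.Injective (π i)) (s : J → Fin m)
    (z : Fin m) (c : ℕ) (h1 : 1 ≤ c) (h2 : c ≤ Load s z) : ∃ b, s b = z ∧ Pos π s b = c := by
  have := (pos_image (univ.filter (fun b => s b = z)) (π z) (hπ z)).1
  have hc : c ∈ Finset.Icc 1 (univ.filter (fun b => s b = z)).card := Finset.mem_Icc.2 ⟨h1, h2⟩
  rw [← this] at hc
  obtain ⟨b, hb, rfl⟩ := Finset.mem_image.1 hc
  have hb : s b = z := by simpa using hb
  subst hb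
  exact ⟨b, rfl, pos_eq _ _ _⟩

lemma insert_iff (π : Fin m → J → ℕ) (hπ : ∀ i, Function.Injective (π i)) (s : J → Fin m)
    (j b : J) (h : s b ≠ s j) :
    π (s b) j < π (s b) b ↔ Pos π (Function.update s j (s b)) j ≤ Pos π s b := by
  rw [pos_upd π hπ s j _ h]
  constructor
  · intro hlt
    apply Nat.succ_le_of_lt
    apply Finset.card_lt_card
    rw [Finset.ssubset_iff_of_subset]
    · exact ⟨b, by simp, by simp; omega⟩
    · intro x hx
      simp only [Finset.mem_filter, Finset.mem_univ, true_and] at hx ⊢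
      exact ⟨hx.1, by omega⟩
  · intro hle
    by_contra hn
    have hne : π (s b) b ≠ π (s b) j := fun e => h (by rw [hπ _ e])
    have : Pos π s b ≤ (univ.filter (fun x => s x = s b ∧ π (s b) x < π (s b) j)).card := by
      apply Finset.card_le_card
      intro x hx
      simp only [Finset.mem_filter, Finset.mem_univ, true_and] at hx ⊢
      exact ⟨hx.1, by omega⟩
    omega

/-- Under stability, deviating to `z` is beneficial iff ... -/
lemma ben_iff (π : Fin m → J → ℕ) (hπ : ∀ i, Function.Injective (π i)) (s : J → Fin m)
    (hstable : StableCost (fun _ => (1:ℝ)) (fun _ => (1:ℝ)) π s) (j : J) (z : Fin m)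
    (h : z ≠ s j) :
    Beneficial (fun _ => (1:ℝ)) (fun _ => (1:ℝ)) π s j z ↔
      Pos π s j = Load s (s j) ∧ Pos π (Function.update s j z) j = Pos π s j ∧
        Pos π s j ≤ Load s z := by
  have hst := hstable j z
  have h1 := pos_pos π s j
  have h2 := pos_le π s j
  have h3 := pos_le π (Function.update s j z) j
  have hi := load_upd_i s j z h
  have hz := load_upd_z s j z h
  have key : ∀ t, ∑ k ∈ (univ.erase (s j)).erase z, min (Load (Function.update s j z) k) t =
      ∑ k ∈ (univ.erase (s j)).erase z, min (Load s k) t := by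
    intro t
    apply Finset.sum_congr rfl
    intro k hk
    simp at hk
    rw [load_upd_o s j z k hk.2 hk.1]
  unfold Beneficial
  rw [ctime_eq, ctime_eq, Nat.cast_lt] at hst
  rw [rank_eq, rank_eq, ctime_eq, ctime_eq, Nat.cast_lt, div_lt_div_iff_of_pos_right (by norm_num),
    Nat.cast_lt]
  simp only [hst, and_false, or_false]
  simp only [cnt_eq π hπ]
  simp only [load_split s (s j) z h, load_split (Function.update s j z) (s j) z h, key]
  rw [Function.update_self] at h3
  rw [hz] at h3
  rw [hz]
  generalize hR : (fun t => ∑ k ∈ (univ.erase (s j)).erase z, min (Load s k) t) = R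
  have hRt : ∀ t, ∑ k ∈ (univ.erase (s j)).erase z, min (Load s k) t = R t := by
    intro t
    rw [← hR]
  have hmono : ∀ a b, a ≤ b → R a ≤ R b := by
    intro a b hab
    rw [← hRt, ← hRt]
    exact Finset.sum_le_sum (fun k _ => by omega)
  simp only [hRt]
  generalize Pos π (Function.update s j z) j = c' at *
  generalize Pos π s j = c at *
  generalize Load (Function.update s j z) (s j) = a at *
  generalize Load s (s j) = b at *
  generalize Load s z = d at *
  rcases Nat.lt_or_ge c c' with hlt | hge
  · have m1 := hmono c c' hlt.le
    have m2 := hmono (c-1) (c'-1) (by omega)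
    omega
  · have : c' = c := by omega
    subst this
    omega

end BenIff

/-- On identical machines with unit jobs, in a profile stable against cost-reducing
deviations, a job `j` has a beneficial deviation iff it is processed last on its machine
and some job `j'` on another machine `z` has the same completion time with `j ≺_z j'`. -/
theorem beneficial_iff {J : Type*} [Fintype J] (m : ℕ)
    (π : Fin m → J → ℕ) (hπ : ∀ i, Function.Injective (π i))
    (s : J → Fin m)
    (hstable : StableCost (fun _ => (1:ℝ)) (fun _ => (1:ℝ)) π s)
    (j : J) :
    (∃ i, Beneficial (fun _ => (1:ℝ)) (fun _ => (1:ℝ)) π s j i) ↔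
      ((∀ j', j' ≠ j → s j' = s j → π (s j) j' < π (s j) j) ∧
        ∃ z, z ≠ s j ∧ ∃ j', s j' = z ∧
          Ctime (fun _ => (1:ℝ)) (fun _ => (1:ℝ)) π s j' =
            Ctime (fun _ => (1:ℝ)) (fun _ => (1:ℝ)) π s j ∧
          π z j < π z j') := by
  constructor
  · rintro ⟨z, hz⟩
    by_cases h : z = s j
    · subst h
      simp [Beneficial] at hz
    · obtain ⟨h1, h2, h3⟩ := (BenIff.ben_iff π hπ s hstable j z h).1 hz
      refine ⟨(BenIff.last_iff π hπ s j).2 h1, z, h, ?_⟩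
      obtain ⟨b, rfl, hb⟩ := BenIff.exists_pos π hπ s z _ (BenIff.pos_pos π s j) h3
      refine ⟨b, rfl, ?_, ?_⟩
      · rw [BenIff.ctime_eq, BenIff.ctime_eq, hb]
      · rw [BenIff.insert_iff π hπ s j b h]
        omega
  · rintro ⟨h1, z, hz, b, rfl, hb, hlt⟩
    refine ⟨s b, (BenIff.ben_iff π hπ s hstable j _ hz).2 ?_⟩
    rw [BenIff.insert_iff π hπ s j b hz] at hlt
    have hst := hstable j (s b)
    rw [BenIff.ctime_eq, BenIff.ctime_eq, Nat.cast_lt] at hst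
    rw [BenIff.ctime_eq, BenIff.ctime_eq, Nat.cast_inj] at hb
    have := BenIff.pos_le π s b
    exact ⟨(BenIff.last_iff π hπ s j).1 h1, by omega, by omega⟩
end
end

section
/- For every integer m ≥ 2 there exists a scheduling game with rank-based utilities G on m identical machines that admits a pure Nash equilibrium and in which every pure Nash equilibrium s satisfies C_max(s) = 2m − 1 while OPT(G) = m; in particular, the price of stability of the class of rank-based scheduling games on m identical machines is at least 2 − 1/m. -/
open Finset
open scoped Classical

noncomputable section

variable {J M : Type*} [Fintype J]

/-- Makespan of profile `s`. -/
def Cmax (p : J → ℝ) (r : M → ℝ) (π : M → J → ℕ) (s : J → M) : ℝ :=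
  ⨆ j, Ctime p r π s j

namespace PoSAux

/-- Number of unit jobs on machine `i`. -/
def load (st : J) (s : J → M) (i : M) : ℕ :=
  (univ.filter (fun j => j ≠ st ∧ s j = i)).card

/-- Number of unit jobs at or before `j` on its machine. -/
def pos (st : J) (π : M → J → ℕ) (s : J → M) (j : J) : ℕ :=
  (univ.filter (fun j' => j' ≠ st ∧ s j' = s j ∧ π (s j) j' ≤ π (s j) j)).card

/-- Processing times. -/
def pt (m : ℕ) (st : J) (j : J) : ℝ := if j = st then (m : ℝ) else 1

/-- Weight used in the rank. -/
def wt (x y : ℝ) : ℝ := if x < y then 1 else if x = y then 1 / 2 else 0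

theorem wt_le_one (x y : ℝ) : wt x y ≤ 1 := by
  unfold wt; split_ifs <;> norm_num

theorem wt_nonneg (x y : ℝ) : 0 ≤ wt x y := by
  unfold wt; split_ifs <;> norm_num

theorem wt_lt {x y : ℝ} (h : x < y) : wt x y = 1 := by simp [wt, h]

theorem wt_gt {x y : ℝ} (h : y < x) : wt x y = 0 := by
  simp [wt, not_lt.2 h.le, h.ne']

theorem wt_self (x : ℝ) : wt x x = 1 / 2 := by simp [wt]

theorem wt_ge {x y : ℝ} (h : y ≤ x) : wt x y ≤ 1 / 2 := by
  unfold wt; rw [if_neg (not_lt.2 h)]; split_ifs <;> norm_num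

theorem wt_mono {x y z : ℝ} (h : y < z) : wt x y ≤ wt x z := by
  rcases le_or_gt x y with h1 | h1
  · rw [wt_lt (h1.trans_lt h)]; exact wt_le_one _ _
  · rw [wt_gt h1]; exact wt_nonneg _ _

theorem rank_eq (p : J → ℝ) (r : M → ℝ) (π : M → J → ℕ) (s : J → M) (j : J) :
    rankOf p r π s j = (∑ j', wt (Ctime p r π s j') (Ctime p r π s j)) + 1 / 2 := by
  have h : ∀ j', wt (Ctime p r π s j') (Ctime p r π s j) =
      (if Ctime p r π s j' < Ctime p r π s j then (1:ℝ) else 0) +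
      (if Ctime p r π s j' = Ctime p r π s j then (1:ℝ) else 0) / 2 := by
    intro j'
    unfold wt
    split_ifs with h1 h2 <;> first | (exfalso; linarith) | norm_num
  simp_rw [h]
  rw [sum_add_distrib, ← sum_div, sum_boole, sum_boole]
  unfold rankOf
  ring

variable {m : ℕ} {st : J} {π : M → J → ℕ}

theorem C_unit (hst : ∀ i j, j ≠ st → π i j < π i st) (s : J → M) {j : J} (hj : j ≠ st) :
    Ctime (pt m st) (fun _ => (1:ℝ)) π s j = pos st π s j := by
  unfold Ctime pos
  rw [div_one, card_eq_sum_ones, Nat.cast_sum]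
  have : (univ.filter (fun j' => s j' = s j ∧ π (s j) j' ≤ π (s j) j)) =
      (univ.filter (fun j' => j' ≠ st ∧ s j' = s j ∧ π (s j) j' ≤ π (s j) j)) := by
    ext x
    simp only [mem_filter, mem_univ, true_and]
    refine ⟨fun h => ⟨?_, h⟩, fun h => h.2⟩
    rintro rfl
    exact absurd h.2 (not_le.2 (hst _ _ hj))
  rw [this]
  refine sum_congr rfl fun x hx => ?_
  simp only [mem_filter, mem_univ, true_and] at hx
  simp [pt, hx.1]

theorem C_star (hst : ∀ i j, j ≠ st → π i j < π i st) (s : J → M) :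
    Ctime (pt m st) (fun _ => (1:ℝ)) π s st = load st s (s st) + m := by
  unfold Ctime load
  rw [div_one, card_eq_sum_ones, Nat.cast_sum]
  have : (univ.filter (fun j' => s j' = s st ∧ π (s st) j' ≤ π (s st) st)) =
      insert st (univ.filter (fun j' => j' ≠ st ∧ s j' = s st)) := by
    ext x
    simp only [mem_filter, mem_univ, true_and, mem_insert]
    by_cases hx : x = st
    · subst hx; simp
    · simp [hx, (hst (s st) x hx).le]
  rw [this, sum_insert (by simp), add_comm]
  congr 1
  · refine sum_congr rfl fun x hx => ?_
    simp only [mem_filter, mem_univ, true_and] at hx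
    simp [pt, hx.1]
  · simp [pt]

theorem pos_le_load (s : J → M) (j : J) : pos st π s j ≤ load st s (s j) := by
  apply card_le_card
  intro x
  simp only [mem_filter, mem_univ, true_and]
  exact fun h => ⟨h.1, h.2.1⟩

theorem exists_last (s : J → M) (i : M) (h : 0 < load st s i) :
    ∃ j, j ≠ st ∧ s j = i ∧ pos st π s j = load st s i := by
  obtain ⟨j, hj, hmax⟩ := exists_max_image _ (π i) (card_pos.1 h)
  simp only [mem_filter, mem_univ, true_and] at hj hmax
  refine ⟨j, hj.1, hj.2, ?_⟩
  unfold pos load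
  congr 1
  ext x
  simp only [mem_filter, mem_univ, true_and, hj.2]
  exact ⟨fun h => ⟨h.1, h.2.1⟩, fun h => ⟨h.1, h.2, hmax x h⟩⟩

theorem pos_lt (s : J → M) {j j' : J} (hj : j ≠ st) (he : s j' = s j)
    (hlt : π (s j) j' < π (s j) j) : pos st π s j' < pos st π s j := by
  apply card_lt_card
  rw [ssubset_iff_of_subset]
  · exact ⟨j, by simp [hj], by simp [he, hlt]⟩
  · intro x
    simp only [mem_filter, mem_univ, true_and, he]
    exact fun h => ⟨h.1, h.2.1, h.2.2.trans hlt.le⟩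

theorem load_update_self (s : J → M) {j : J} (hj : j ≠ st) {b : M} (hb : s j ≠ b) :
    load st (Function.update s j b) b = load st s b + 1 := by
  unfold load
  have : (univ.filter (fun x => x ≠ st ∧ Function.update s j b x = b)) =
      insert j (univ.filter (fun x => x ≠ st ∧ s x = b)) := by
    ext x
    simp only [mem_filter, mem_univ, true_and, mem_insert]
    by_cases hx : x = j
    · subst hx; simp [hj]
    · simp [hx]
  rw [this, card_insert_of_notMem (by simp [hb])]

theorem pos_update_le (s : J → M) {j x : J} {b : M} (hx : x ≠ j) (hxb : s x ≠ b) :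
    pos st π (Function.update s j b) x ≤ pos st π s x := by
  apply card_le_card
  intro y
  simp only [mem_filter, mem_univ, true_and, Function.update_of_ne hx]
  rintro ⟨h1, h2, h3⟩
  by_cases hy : y = j
  · subst hy; simp at h2; exact absurd h2.symm hxb
  · rw [Function.update_of_ne hy] at h2; exact ⟨h1, h2, h3⟩

theorem pos_update_eq (s : J → M) {j x : J} {b : M} (hx : x ≠ j) (hxb : s x ≠ b)
    (hxa : s x ≠ s j) :
    pos st π (Function.update s j b) x = pos st π s x := by
  unfold pos
  congr 1
  ext y
  simp only [mem_filter, mem_univ, true_and, Function.update_of_ne hx]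
  by_cases hy : y = j
  · subst hy; simp [Ne.symm hxb, Ne.symm hxa]
  · rw [Function.update_of_ne hy]

theorem pos_update_star (s : J → M) {x : J} {b : M} (hx : x ≠ st) :
    pos st π (Function.update s st b) x = pos st π s x := by
  unfold pos
  congr 1
  ext y
  simp only [mem_filter, mem_univ, true_and, Function.update_of_ne hx]
  by_cases hy : y = st
  · simp [hy]
  · rw [Function.update_of_ne hy]

theorem load_update_star (s : J → M) (b i : M) :
    load st (Function.update s st b) i = load st s i := by
  unfold load
  congr 1
  ext y
  simp only [mem_filter, mem_univ, true_and]
  by_cases hy : y = st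
  · simp [hy]
  · rw [Function.update_of_ne hy]

/-- Moving the last unit job from an overloaded to an underloaded machine is beneficial. -/
theorem not_NE (hinj : ∀ i, Function.Injective (π i)) (hst : ∀ i j, j ≠ st → π i j < π i st)
    (s : J → M) (a b : M)
    (ha : m ≤ load st s a) (hb : load st s b + 1 < m) :
    ¬ IsNE (pt m st) (fun _ => (1:ℝ)) π s := by
  intro hNE
  obtain ⟨j, hj, hja, hpos⟩ := exists_last (st := st) (π := π) s a (by omega)
  apply hNE j b
  have hab : s j ≠ b := by rintro rfl; rw [← hja] at ha; omega
  set s' := Function.update s j b with hs'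
  have hs'j : s' j = b := by simp [s']
  have hC := C_unit (m := m) hst s hj
  have hC' := C_unit (m := m) hst s' hj
  have hle : pos st π s' j ≤ load st s b + 1 := by
    have := pos_le_load (st := st) (π := π) s' j
    rwa [hs'j, load_update_self s hj hab] at this
  have hlt : Ctime (pt m st) (fun _ => (1:ℝ)) π s' j < Ctime (pt m st) (fun _ => (1:ℝ)) π s j := by
    rw [hC, hC']; exact_mod_cast (by omega : pos st π s' j < pos st π s j)
  have hr : rankOf (pt m st) (fun _ => (1:ℝ)) π s' j ≤ rankOf (pt m st) (fun _ => (1:ℝ)) π s j := by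
    rw [rank_eq, rank_eq]
    refine add_le_add (sum_le_sum fun x _ => ?_) le_rfl
    by_cases hxj : x = j
    · subst hxj; rw [wt_self, wt_self]
    by_cases hx : x = st
    · subst hx
      rw [wt_gt]
      · exact wt_nonneg _ _
      · rw [hC', C_star hst]
        exact_mod_cast (by omega : pos x π s' j < load x s' (s' x) + m)
    by_cases hxa : s x = s j
    · rw [wt_lt (y := Ctime (pt m st) (fun _ => (1:ℝ)) π s j)]
      · exact wt_le_one _ _
      · rw [hC, C_unit hst s hx]
        have h1 := pos_le_load (st := st) (π := π) s x
        rw [hxa, hja] at h1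
        rcases lt_trichotomy (π (s j) x) (π (s j) j) with h | h | h
        · exact_mod_cast pos_lt s hj hxa h
        · exact absurd (hinj _ h) hxj
        · have := pos_lt (st := st) s hx hxa.symm (by rwa [hxa])
          omega
    by_cases hxb : s x = b
    · rw [wt_lt (y := Ctime (pt m st) (fun _ => (1:ℝ)) π s j)]
      · exact wt_le_one _ _
      · rw [hC, C_unit hst s hx]
        have h1 := pos_le_load (st := st) (π := π) s x
        rw [hxb] at h1
        exact_mod_cast (by omega : pos st π s x < pos st π s j)
    · rw [C_unit hst s' hx, pos_update_eq s hxj hxb hxa, ← C_unit (m := m) hst s hx]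
      exact wt_mono hlt
  rcases hr.lt_or_eq with h | h
  · exact Or.inl h
  · exact Or.inr ⟨h, hlt⟩

theorem home_NE (hm : 2 ≤ m) (hst : ∀ i j, j ≠ st → π i j < π i st)
    (g : J → M) (hg : ∀ i, load st g i = m - 1)
    (hhome : ∀ j j', j ≠ st → j' ≠ st → g j ≠ g j' → π (g j) j < π (g j) j') :
    IsNE (pt m st) (fun _ => (1:ℝ)) π g := by
  intro j b hben
  by_cases hj : j = st
  · subst hj
    have hC : ∀ x, Ctime (pt m j) (fun _ => (1:ℝ)) π (Function.update g j b) x =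
        Ctime (pt m j) (fun _ => (1:ℝ)) π g x := by
      intro x
      by_cases hx : x = j
      · subst hx
        rw [C_star hst, C_star hst, load_update_star, hg, hg]
      · rw [C_unit hst _ hx, C_unit hst _ hx, pos_update_star g hx]
    unfold Beneficial rankOf at hben
    simp [hC] at hben
  by_cases hb : g j = b
  · subst hb
    simp [Beneficial] at hben
  set s' := Function.update g j b with hs'
  have hs'j : s' j = b := by simp [s']
  have hC := C_unit (m := m) hst g hj
  have hC' := C_unit (m := m) hst s' hj
  have hp : pos st π g j ≤ m - 1 := by
    have := pos_le_load (st := st) (π := π) g j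
    rwa [hg] at this
  have hp' : pos st π s' j = m := by
    have h1 : pos st π s' j = load st s' b := by
      unfold pos load
      congr 1
      ext x
      simp only [mem_filter, mem_univ, true_and, hs'j]
      refine ⟨fun h => ⟨h.1, h.2.1⟩, fun h => ⟨h.1, h.2, ?_⟩⟩
      by_cases hxj : x = j
      · rw [hxj]
      · have h2 := h.2
        rw [hs', Function.update_of_ne hxj] at h2
        have := hhome x j h.1 hj (by rw [h2]; exact Ne.symm hb)
        rw [h2] at this
        exact this.le
    rw [h1, load_update_self g hj hb, hg]; omega
  have hunit : ∀ x, x ≠ j → x ≠ st → pos st π s' x < pos st π s' j := by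
    intro x hxj hx
    have hs'x : s' x = g x := by simp [s', hxj]
    by_cases hxb : g x = b
    · apply pos_lt s' hj (by rw [hs'x, hs'j, hxb])
      rw [hs'j, ← hxb]
      exact hhome x j hx hj (by rw [hxb]; exact Ne.symm hb)
    · have h1 := pos_update_le (st := st) (π := π) g hxj hxb
      have h2 := pos_le_load (st := st) (π := π) g x
      rw [hg] at h2
      rw [← hs'] at h1
      omega
  have hr : rankOf (pt m st) (fun _ => (1:ℝ)) π g j < rankOf (pt m st) (fun _ => (1:ℝ)) π s' j := by
    rw [rank_eq, rank_eq]
    refine add_lt_add_of_lt_of_le (sum_lt_sum (fun x _ => ?_) ?_) le_rfl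
    · by_cases hxj : x = j
      · subst hxj; rw [wt_self, wt_self]
      by_cases hx : x = st
      · subst hx
        rw [wt_gt]
        · exact wt_nonneg _ _
        · rw [hC, C_star hst]
          exact_mod_cast (by omega : pos x π g j < load x g (g x) + m)
      · rw [wt_lt (y := Ctime (pt m st) (fun _ => (1:ℝ)) π s' j)]
        · exact wt_le_one _ _
        · rw [hC', C_unit hst s' hx]
          exact_mod_cast hunit x hxj hx
    · obtain ⟨x, hx, hxb, hxp⟩ := exists_last (st := st) (π := π) g b (by rw [hg]; omega)
      have hxj : x ≠ j := by rintro rfl; exact hb hxb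
      refine ⟨x, mem_univ _, ?_⟩
      rw [wt_lt (y := Ctime (pt m st) (fun _ => (1:ℝ)) π s' j)]
      · refine (wt_ge ?_).trans_lt (by norm_num)
        rw [hC, C_unit hst g hx]
        rw [hg] at hxp
        exact_mod_cast (by omega : pos st π g j ≤ pos st π g x)
      · rw [hC', C_unit hst s' hx]
        exact_mod_cast hunit x hxj hx
  rcases hben with h | h
  · exact lt_asymm h hr
  · exact hr.ne' h.1

theorem Cmax_eq (hst : ∀ i j, j ≠ st → π i j < π i st) (s : J → M)
    (h : ∀ i, load st s i ≤ load st s (s st) + m) :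
    Cmax (pt m st) (fun _ => (1:ℝ)) π s = load st s (s st) + m := by
  have : Nonempty J := ⟨st⟩
  unfold Cmax
  apply le_antisymm
  · refine ciSup_le fun j => ?_
    by_cases hj : j = st
    · subst hj; rw [C_star hst]
    · rw [C_unit hst s hj]
      exact_mod_cast (pos_le_load s j).trans (h _)
  · rw [← C_star (π := π) hst s]
    exact le_ciSup (Set.finite_range _).bddAbove st

theorem Cmax_ge (hst : ∀ i j, j ≠ st → π i j < π i st) (s : J → M) :
    (m : ℝ) ≤ Cmax (pt m st) (fun _ => (1:ℝ)) π s := by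
  have h1 : Ctime (pt m st) (fun _ => (1:ℝ)) π s st ≤ Cmax (pt m st) (fun _ => (1:ℝ)) π s :=
    le_ciSup (f := fun j => Ctime (pt m st) (fun _ => (1:ℝ)) π s j)
      (Set.finite_range _).bddAbove st
  rw [C_star hst] at h1
  have : (0:ℝ) ≤ load st s (s st) := Nat.cast_nonneg _
  linarith

theorem sum_load [Fintype M] (s : J → M) :
    ∑ i, load st s i = (univ.filter (fun j : J => j ≠ st)).card := by
  rw [card_eq_sum_card_fiberwise (f := s) (t := univ) (by simp)]
  refine sum_congr rfl fun i _ => ?_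
  unfold load
  rw [filter_filter]

theorem balanced [Fintype M] (hm : 2 ≤ m) (hinj : ∀ i, Function.Injective (π i))
    (hst : ∀ i j, j ≠ st → π i j < π i st)
    (g s : J → M) (hg : ∀ i, load st g i = m - 1)
    (hs : IsNE (pt m st) (fun _ => (1:ℝ)) π s) (i : M) : load st s i = m - 1 := by
  have hsum : ∑ i, load st s i = ∑ i : M, (m - 1) := by
    rw [sum_load, ← sum_load g]; exact sum_congr rfl fun i _ => hg i
  by_cases hA : ∃ a, m ≤ load st s a
  · obtain ⟨a, ha⟩ := hA
    have hB : ∀ b, m - 1 ≤ load st s b := by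
      intro b
      by_contra hb
      exact not_NE hinj hst s a b ha (by omega) hs
    exact ((sum_eq_sum_iff_of_le (fun i _ => hB i)).1 hsum.symm i (mem_univ _)).symm
  · push Not at hA
    have hB : ∀ b, load st s b ≤ m - 1 := fun b => by have := hA b; omega
    exact (sum_eq_sum_iff_of_le (fun i _ => hB i)).1 hsum i (mem_univ _)

theorem load_eq_card (s : J → M) (i : M) (S : Finset J) (h : ∀ j, (j ≠ st ∧ s j = i) ↔ j ∈ S) :
    load st s i = S.card := by
  unfold load
  congr 1
  ext j
  simp [← h]

theorem load_le_card (s : J → M) (i : M) (S : Finset J) (h : ∀ j, j ≠ st → s j = i → j ∈ S) :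
    load st s i ≤ S.card := by
  unfold load
  refine card_le_card fun j hj => ?_
  simp only [mem_filter, mem_univ, true_and] at hj
  exact h j hj.1 hj.2

/-- Home machine of a job on the concrete index type. -/
def homeM (m : ℕ) (hm : 2 ≤ m) : Option (Fin m × Fin (m - 1)) → Fin m
  | none => ⟨0, by omega⟩
  | some x => x.1

/-- The optimal assignment: the long job alone on machine zero. -/
def optM (m : ℕ) (hm : 2 ≤ m) : Option (Fin m × Fin (m - 1)) → Fin m
  | none => ⟨0, by omega⟩
  | some x => ⟨x.2.1 + 1, by have := x.2.2; omega⟩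

end PoSAux

open PoSAux

/-- PoS lower bound on `m` identical machines: there is a game in which a NE exists,
every NE has makespan `2m - 1`, and the optimal makespan is `m`. -/
theorem PoS_identical_lower (m : ℕ) (hm : 2 ≤ m) :
    ∃ (n : ℕ) (p : Fin n → ℝ) (π : Fin m → Fin n → ℕ),
      0 < n ∧ (∀ j, 0 < p j) ∧ (∀ i, Function.Injective (π i)) ∧
      (∃ s : Fin n → Fin m, IsNE p (fun _ => (1:ℝ)) π s) ∧
      (∀ s : Fin n → Fin m, IsNE p (fun _ => (1:ℝ)) π s →
        Cmax p (fun _ => (1:ℝ)) π s = 2 * (m : ℝ) - 1) ∧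
      (∃ t : Fin n → Fin m, Cmax p (fun _ => (1:ℝ)) π t = (m : ℝ)) ∧
      (∀ t : Fin n → Fin m, (m : ℝ) ≤ Cmax p (fun _ => (1:ℝ)) π t) := by
  obtain ⟨n, ⟨e⟩⟩ := Finite.exists_equiv_fin (Option (Fin m × Fin (m - 1)))
  set st : Fin n := e none with hstd
  have hes : ∀ j, j ≠ st → ∃ x, e (some x) = j := by
    intro j hj
    rcases h : e.symm j with _ | x
    · exact absurd (by rw [hstd, ← h, e.apply_symm_apply]) hj
    · exact ⟨x, by rw [← h, e.apply_symm_apply]⟩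
  let g : Fin n → Fin m := fun j => homeM m hm (e.symm j)
  let t : Fin n → Fin m := fun j => optM m hm (e.symm j)
  let π : Fin m → Fin n → ℕ := fun i j =>
    if j = st then 2 * n else if g j = i then j.1 else n + j.1
  have hinj : ∀ i, Function.Injective (π i) := by
    intro i x y h
    have hx := x.2
    have hy := y.2
    simp only [π] at h
    split_ifs at h with h1 h2 h3 h4 h5 h6 h7 <;> first | (exfalso; omega) | skip
    · rw [h1, h2]
    all_goals exact Fin.ext (by omega)
  have hst : ∀ i j, j ≠ st → π i j < π i st := by
    intro i j hj
    have hx := j.2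
    simp only [π, if_neg hj, if_true]
    split_ifs <;> omega
  have hhome : ∀ j j', j ≠ st → j' ≠ st → g j ≠ g j' → π (g j) j < π (g j) j' := by
    intro j j' hj hj' h
    have hx := j.2
    simp only [π, if_neg hj, if_neg hj', if_true, if_neg (Ne.symm h)]
    omega
  have hg : ∀ i, load st g i = m - 1 := by
    intro i
    rw [load_eq_card g i ((univ : Finset (Fin (m - 1))).image (fun k => e (some (i, k)))),
      card_image_of_injective _ (fun a b h => by simpa using h)]
    · simp
    intro j
    simp only [mem_univ, true_and, mem_image]
    constructor
    · rintro ⟨h1, h2⟩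
      obtain ⟨x, rfl⟩ := hes j h1
      simp only [g, homeM, Equiv.symm_apply_apply] at h2
      exact ⟨x.2, by rw [← h2]⟩
    · rintro ⟨k, rfl⟩
      simp [g, homeM, hstd]
  have ht : ∀ i, load st t i ≤ m := by
    intro i
    have := load_le_card (st := st) t i ((univ : Finset (Fin m)).image
          (fun k => e (some (k, ⟨i.1 - 1, by have := i.2; omega⟩)))) (by
      intro j h1 h2
      simp only [mem_univ, true_and, mem_image]
      obtain ⟨x, rfl⟩ := hes j h1
      simp only [t, optM, Equiv.symm_apply_apply] at h2
      refine ⟨x.1, ?_⟩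
      subst h2
      simp)
    refine this.trans (card_image_le.trans ?_)
    simp
  have ht0 : load st t (t st) = 0 := by
    have := load_le_card (st := st) t (t st) ∅ (by
      intro j h1 h2
      obtain ⟨x, rfl⟩ := hes j h1
      simp [t, optM, hstd] at h2)
    simpa using this
  refine ⟨n, pt m st, π, ?_, ?_, hinj, ⟨g, home_NE hm hst g hg hhome⟩, ?_, ⟨t, ?_⟩, ?_⟩
  · exact lt_of_le_of_lt (Nat.zero_le _) st.2
  · intro j
    unfold pt
    split_ifs
    · exact_mod_cast (by omega : 0 < m)
    · norm_num
  · intro s hs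
    have hb := balanced hm hinj hst g s hg hs
    rw [Cmax_eq hst s (fun i => by rw [hb, hb]; omega), hb, Nat.cast_sub (by omega)]
    push_cast
    ring
  · rw [Cmax_eq hst t (fun i => by have := ht i; omega), ht0]
    simp
  · exact fun t => Cmax_ge hst t
end
end
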